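/- arXiv:1905.12624 — 3 statements merged into one kernel-verified Lean document; each statement's English description precedes it below -/
import Mathlib

section
/- Let n ≥ 1, 1 ≤ k < n, ε ≥ 0, and let v, w : Fin n → ℝ satisfy |v(i) − w(i)| ≤ ε for every i. If an index i satisfies w(i) − w_{(k+1)} > 2ε, where w_{(k+1)} is the (k+1)-th largest value of w, then v(i) > v_{(k+1)}, the (k+1)-th largest value of v; in particular, v(i) is among the k largest values of v. -/
open Finset

/-- `sortedDesc v j` is the `(j+1)`-th largest value of `v` (so `sortedDesc v 0`
is the largest): the values of `v` sorted in decreasing order. -/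
noncomputable def sortedDesc {n : ℕ} (v : Fin n → ℝ) : Fin n → ℝ :=
  fun j => (v ∘ Tuple.sort v) j.rev

/-- Two permutations of `Fin n` admit a common value taken by the first at a position `≥ m` and by
the second at a position `≤ m`. -/
lemma perm_exists_eq_of_le_of_le {n : ℕ} (σ τ : Equiv.Perm (Fin n)) (m : Fin n) :
    ∃ p q, m ≤ p ∧ q ≤ m ∧ σ p = τ q := by
  by_contra! h
  have hdisj : Disjoint ((Finset.Ici m).map σ.toEmbedding) ((Finset.Iic m).map τ.toEmbedding) := by
    rw [Finset.disjoint_left]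
    intro a ha hb
    obtain ⟨p, hp, rfl⟩ := Finset.mem_map.1 ha
    obtain ⟨q, hq, hqp⟩ := Finset.mem_map.1 hb
    exact h p q (Finset.mem_Ici.1 hp) (Finset.mem_Iic.1 hq) hqp.symm
  have hcard := Finset.card_le_univ (Finset.disjUnion _ _ hdisj)
  rw [Finset.card_disjUnion, Finset.card_map, Finset.card_map, Fin.card_Ici, Fin.card_Iic,
    Fintype.card_fin] at hcard
  have := m.isLt
  omega

/-- If `v ≤ w + ε` pointwise, the same holds for the order statistics. -/
lemma sortedDesc_le_add {n : ℕ} {v w : Fin n → ℝ} {ε : ℝ} (h : ∀ i, v i ≤ w i + ε) (j : Fin n) :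
    sortedDesc v j ≤ sortedDesc w j + ε := by
  obtain ⟨p, q, hp, hq, hpq⟩ :=
    perm_exists_eq_of_le_of_le (Tuple.sort v) (Tuple.sort w) j.rev
  calc sortedDesc v j ≤ v (Tuple.sort v p) := Tuple.monotone_sort v hp
    _ ≤ w (Tuple.sort v p) + ε := h _
    _ = w (Tuple.sort w q) + ε := by rw [hpq]
    _ ≤ sortedDesc w j + ε := by
      gcongr
      exact Tuple.monotone_sort w hq

/-- Correctness of CSAR's acceptance rule: if the estimate `w i` exceeds the
`(k+1)`-th largest estimate by more than `2ε`, and estimates are `ε`-accurate,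
then the true value `v i` exceeds the `(k+1)`-th largest true value, so `i` is
among the top `k` arms. -/
theorem accept_rule_correct (n k : ℕ) (hn : 1 ≤ n) (hk1 : 1 ≤ k) (hkn : k < n)
    (ε : ℝ) (hε : 0 ≤ ε)
    (v w : Fin n → ℝ) (hclose : ∀ i, |v i - w i| ≤ ε)
    (i : Fin n) (haccept : w i - sortedDesc w ⟨k, hkn⟩ > 2 * ε) :
    v i > sortedDesc v ⟨k, hkn⟩ := by
  have hk := sortedDesc_le_add (v := v) (w := w) (ε := ε)
    (fun j => by linarith [(abs_le.1 (hclose j)).2]) ⟨k, hkn⟩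
  linarith [(abs_le.1 (hclose i)).1]
end

section
/- Let n ≥ 1, 1 ≤ k ≤ n, ε ≥ 0, and let v, w : Fin n → ℝ satisfy |v(i) − w(i)| ≤ ε for every i. If an index i satisfies w_{(k)} − w(i) > 2ε, where w_{(k)} is the k-th largest value of w, then v(i) < v_{(k)}, the k-th largest value of v; in particular, v(i) is not among the k largest values of v. -/
open Finset

/-- A permutation of a finite linear order sends some element `s ≥ r` to an element `≤ r`. -/
theorem Equiv.Perm.exists_le_and_apply_le {α : Type*} [Fintype α] [LinearOrder α]
    (p : Equiv.Perm α) (r : α) : ∃ s, r ≤ s ∧ p s ≤ r := by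
  by_contra! h
  have hcard : (univ.filter (r ≤ ·)).card ≤ (univ.filter (r < ·)).card :=
    card_le_card_of_injOn p (fun s hs => by simpa using h s (by simpa using hs))
      p.injective.injOn
  refine hcard.not_gt (card_lt_card ?_)
  rw [ssubset_iff_of_subset (monotone_filter_right _ fun _ _ => le_of_lt)]
  exact ⟨r, by simp, by simp⟩

/-- Correctness of CSAR's rejection rule: if the estimate `w i` is below the
`k`-th largest estimate by more than `2ε`, and estimates are `ε`-accurate,
then the true value `v i` is below the `k`-th largest true value, so `i` is not
among the top `k` arms. -/
theorem reject_rule_correct (n k : ℕ) (hn : 1 ≤ n) (hk1 : 1 ≤ k) (hkn : k ≤ n)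
    (ε : ℝ) (hε : 0 ≤ ε)
    (v w : Fin n → ℝ) (hclose : ∀ i, |v i - w i| ≤ ε)
    (i : Fin n) (hreject : sortedDesc w ⟨k - 1, by omega⟩ - w i > 2 * ε) :
    v i < sortedDesc v ⟨k - 1, by omega⟩ := by
  unfold sortedDesc at *
  obtain ⟨s, hs, hp⟩ := Equiv.Perm.exists_le_and_apply_le
    ((Tuple.sort w).trans (Tuple.sort v).symm) (Fin.rev ⟨k - 1, by omega⟩)
  have hw := Tuple.monotone_sort w hs
  have hv := Tuple.monotone_sort v hp
  simp only [Function.comp_apply, Equiv.trans_apply, Equiv.apply_symm_apply] at *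
  have hi := abs_le.mp (hclose i)
  have hj := abs_le.mp (hclose (Tuple.sort w s))
  linarith
end

section
/- Let l ≥ 1, let a₁ ≥ a₂ ≥ … ≥ a_l be a nonincreasing sequence of reals, and let b > 0 satisfy a_l ≥ b. Then ∑_{j=1}^{l−1} (a_j − a_{j+1})/a_j² + (a_l + b)/a_l² ≤ 3/b. -/
open Finset

/-- A left-endpoint Riemann sum of `1 / x ^ 2` over a nonincreasing positive sequence is at most
the reciprocal of the last term. -/
lemma sum_sub_div_sq_le_inv (a : ℕ → ℝ) (n : ℕ)
    (hmono : ∀ j, 1 ≤ j → j < n + 1 → a (j + 1) ≤ a j) (hpos : 0 < a (n + 1)) :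
    ∑ j ∈ Finset.Icc 1 n, (a j - a (j + 1)) / (a j) ^ 2 ≤ 1 / a (n + 1) := by
  induction n with
  | zero => simpa using hpos.le
  | succ n ih =>
    have hle : a (n + 1 + 1) ≤ a (n + 1) := hmono (n + 1) (by omega) (by omega)
    have hpos' : 0 < a (n + 1) := hpos.trans_le hle
    have ih' := ih (fun j h1 h2 => hmono j h1 (by omega)) hpos'
    rw [Finset.sum_Icc_succ_top (by omega)]
    have hstep : (a (n + 1) - a (n + 1 + 1)) / a (n + 1) ^ 2
        ≤ 1 / a (n + 1 + 1) - 1 / a (n + 1) := by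
      have hdiff : 1 / a (n + 1 + 1) - 1 / a (n + 1)
          - (a (n + 1) - a (n + 1 + 1)) / a (n + 1) ^ 2
          = (a (n + 1) - a (n + 1 + 1)) ^ 2 / (a (n + 1) ^ 2 * a (n + 1 + 1)) := by
        field_simp
      have : 0 ≤ (a (n + 1) - a (n + 1 + 1)) ^ 2 / (a (n + 1) ^ 2 * a (n + 1 + 1)) := by
        positivity
      linarith
    linarith

/-- For a nonincreasing sequence `a 1 ≥ … ≥ a l` with `a l ≥ b > 0`,
`∑_{j=1}^{l−1} (a j − a (j+1)) / (a j)² + (a l + b) / (a l)² ≤ 3 / b`. -/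
theorem per_arm_regret_bound (l : ℕ) (hl : 1 ≤ l) (a : ℕ → ℝ)
    (hmono : ∀ j, 1 ≤ j → j < l → a (j + 1) ≤ a j)
    (b : ℝ) (hb : 0 < b) (hab : b ≤ a l) :
    ∑ j ∈ Finset.Icc 1 (l - 1), (a j - a (j + 1)) / (a j) ^ 2
        + (a l + b) / (a l) ^ 2 ≤ 3 / b := by
  have hpos : 0 < a l := hb.trans_le hab
  have hsum := sum_sub_div_sq_le_inv a (l - 1)
    (fun j h1 h2 => hmono j h1 (by omega)) (by rwa [Nat.sub_add_cancel hl])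
  rw [Nat.sub_add_cancel hl] at hsum
  have hlast : (a l + b) / a l ^ 2 ≤ 2 / a l := by
    rw [div_le_div_iff₀ (by positivity) hpos]
    nlinarith [mul_le_mul_of_nonneg_right hab hpos.le]
  calc _ ≤ 1 / a l + 2 / a l := add_le_add hsum hlast
    _ = 3 / a l := by ring
    _ ≤ 3 / b := by gcongr
end
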